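/- arXiv:math/9802012 — 3 statements merged into one kernel-verified Lean document; each statement's English description precedes it below -/
import Mathlib

section
/- Let A be a commutative ring, let B be a smooth commutative A-algebra, and let l ≥ 1. Let T = B^{⊗_A l}, μ : T → B the multiplication map, and I = ker μ; the symmetric group Σ_l acts on T by permuting the tensor factors, and this induces an action on the B-module I/I² (the B-module structure coming from T/I ≅ B). Let H = {(b_1,…,b_l) ∈ B^l : b_1 + ⋯ + b_l = 0}, a B-module on which Σ_l acts by permuting coordinates. Then the B-linear map α : Ω_{B/A} ⊗_B H → I/I² determined by α(db ⊗ (e_i − e_{i+1})) = class of ι_i(b) − ι_{i+1}(b) (for b ∈ B and 1 ≤ i ≤ l−1) is a well-defined B-linear isomorphism, and α is Σ_l-equivariant when Σ_l acts trivially on Ω_{B/A}. -/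
universe u

section
open scoped TensorProduct

theorem core_e {A B T : Type u} [CommRing A] [CommRing B] [Algebra A B] [CommRing T] [Algebra A T]
    (μ : T →ₐ[A] B) (ι : B →ₐ[A] T) (hμι : ∀ b, μ (ι b) = b)
    [Module B (RingHom.ker μ).Cotangent]
    (hsm : ∀ (b : B) (x : (RingHom.ker μ).Cotangent), b • x = ι b • x) :
    (∀ (t : T) (x : (RingHom.ker μ).Cotangent), t • x = μ t • x) ∧
    ∃ e : T →ₗ[A] (RingHom.ker μ).Cotangent,
      (∀ s t, e (s * t) = μ s • e t + μ t • e s) ∧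
      (∀ t (w : RingHom.ker μ), (w : T) = t - ι (μ t) → e t = (RingHom.ker μ).toCotangent w) := by
  have hk : ∀ t, t - ι (μ t) ∈ RingHom.ker μ := fun t => by
    simp [RingHom.mem_ker, hμι]
  have h1 : ∀ (t : T) (x : (RingHom.ker μ).Cotangent), t • x = μ t • x := by
    intro t x
    rw [hsm, ← sub_eq_zero, ← sub_smul]
    exact Ideal.Cotangent.smul_eq_zero_of_mem (hk t) x
  refine ⟨h1, ?_⟩
  refine ⟨{ toFun := fun t => (RingHom.ker μ).toCotangent ⟨t - ι (μ t), hk t⟩,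
            map_add' := ?_, map_smul' := ?_ }, ?_, ?_⟩
  · intro s t
    rw [← map_add]; congr 1; ext; simp; ring
  · intro a t
    rw [RingHom.id_apply, ← algebraMap_smul T a ((RingHom.ker μ).toCotangent _), ← map_smul]
    congr 1; ext
    simp [Algebra.smul_def, mul_sub]
  · intro s t
    rw [← h1, hsm]
    simp only [LinearMap.coe_mk, AddHom.coe_mk]
    rw [← map_smul, ← map_smul, ← map_add]
    congr 1; ext; simp; ring
  · intro t w hw
    simp only [LinearMap.coe_mk, AddHom.coe_mk]
    congr 1; ext; exact hw.symm

theorem core_iso {A B T : Type u} [CommRing A] [CommRing B] [Algebra A B] [CommRing T] [Algebra A T]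
    {l : ℕ}
    (μ : T →ₐ[A] B) (ι : Fin l → (B →ₐ[A] T)) (o : Fin l) (hμι : ∀ i b, μ (ι i b) = b)
    (H : Submodule B (Fin l → B))
    (hH : ∀ v : Fin l → B, v ∈ H ↔ ∑ i, v i = 0)
    [Module B (RingHom.ker μ).Cotangent]
    (hsm : ∀ (b : B) (x : (RingHom.ker μ).Cotangent), b • x = ι o b • x)
    (hgen : Algebra.adjoin A (⋃ i, Set.range (ι i)) = ⊤)
    (δ : T →ₗ[A] (Ω[B⁄A]) ⊗[B] ↥H)
    (hδ : ∀ s t, δ (s * t) = μ s • δ t + μ t • δ s)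
    (hδι : ∀ i b (v : H), (v : Fin l → B) = Pi.single i 1 - Pi.single o 1 →
      δ (ι i b) = KaehlerDifferential.D A B b ⊗ₜ[B] v) :
    ∃ α : ((Ω[B⁄A]) ⊗[B] ↥H) ≃ₗ[B] (RingHom.ker μ).Cotangent,
      ∀ (b : B) (v : H) (w : Fin l → RingHom.ker μ), (∀ i, (w i : T) = ι i b - ι o b) →
        α (KaehlerDifferential.D A B b ⊗ₜ[B] v) =
          ∑ i, (v : Fin l → B) i • (RingHom.ker μ).toCotangent (w i) := by
  obtain ⟨h1, e, he, hew⟩ := core_e μ (ι o) (hμι o) hsm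
  have : IsScalarTower A B (RingHom.ker μ).Cotangent := ⟨fun a b x => by
    rw [hsm, hsm, map_smul, smul_assoc]⟩
  let d : Fin l → Derivation A B (RingHom.ker μ).Cotangent := fun i =>
    Derivation.mk' (e ∘ₗ (ι i).toLinearMap) (fun a b => by simp [he, hμι])
  have hd : ∀ i b, d i b = e (ι i b) := fun i b => rfl
  let α₀ : (Ω[B⁄A]) ⊗[B] ↥H →ₗ[B] (RingHom.ker μ).Cotangent :=
    TensorProduct.lift (LinearMap.mk₂ B
      (fun ω v => ∑ i, (v : Fin l → B) i • (d i).liftKaehlerDifferential ω)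
      (fun m₁ m₂ n => by simp [Finset.sum_add_distrib])
      (fun c m n => by simp [Finset.smul_sum, smul_comm c])
      (fun m n₁ n₂ => by simp [Finset.sum_add_distrib, add_smul])
      (fun c m n => by simp [Finset.smul_sum, mul_smul]))
  have hα : ∀ b (v : H), α₀ (KaehlerDifferential.D A B b ⊗ₜ[B] v) =
      ∑ i, (v : Fin l → B) i • e (ι i b) := by
    intro b v
    simp [α₀, hd]
  have hvi : ∀ i : Fin l, (Pi.single i 1 - Pi.single o 1 : Fin l → B) ∈ H := by
    intro i; rw [hH]; simp
  have he1 : ∀ b, e (ι o b) = 0 := fun b => by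
    rw [hew (ι o b) 0 (by simp [hμι]), map_zero]
  have hδ1 : ∀ b, δ (ι o b) = 0 := fun b => by
    rw [hδι o b 0 (by simp), TensorProduct.tmul_zero]
  have hαδ : ∀ t, α₀ (δ t) = e t := by
    intro t
    have ht : t ∈ Algebra.adjoin A (⋃ i, Set.range (ι i)) := by rw [hgen]; trivial
    induction ht using Algebra.adjoin_induction with
    | mem x hx =>
      obtain ⟨i, b, rfl⟩ := Set.mem_iUnion.1 hx
      rw [hδι i b ⟨_, hvi i⟩ rfl, hα]
      simp [sub_smul, Finset.sum_sub_distrib, he1, Pi.single_apply, ite_smul]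
    | algebraMap r =>
      rw [← (ι o).commutes, hδ1, he1, map_zero]
    | add x y _ _ hx hy => simp [hx, hy]
    | mul x y _ _ hx hy => simp [hδ, he, hx, hy]
  have hsurj : Function.Surjective α₀ := by
    intro x
    obtain ⟨w, rfl⟩ := Ideal.toCotangent_surjective _ x
    refine ⟨δ w, ?_⟩
    rw [hαδ]
    refine hew _ _ ?_
    rw [(RingHom.mem_ker).1 w.2]; simp
  have hδ2 : ∀ t ∈ (RingHom.ker μ) ^ 2, δ t = 0 := by
    intro t ht
    rw [pow_two] at ht
    induction ht using Submodule.mul_induction_on' with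
    | mem_mul_mem x hx y hy =>
      rw [hδ, RingHom.mem_ker.1 hx, RingHom.mem_ker.1 hy]; simp
    | add x _ y _ hx hy => rw [map_add, hx, hy, add_zero]
  have hlift : ∀ x, ∃ w : RingHom.ker μ, (RingHom.ker μ).toCotangent w = α₀ x ∧ δ w = x := by
    have hadd : ∀ x y, (∃ w : RingHom.ker μ, (RingHom.ker μ).toCotangent w = α₀ x ∧ δ w = x) →
      (∃ w : RingHom.ker μ, (RingHom.ker μ).toCotangent w = α₀ y ∧ δ w = y) →
      (∃ w : RingHom.ker μ, (RingHom.ker μ).toCotangent w = α₀ (x + y) ∧ δ w = x + y) := by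
      rintro x y ⟨w, h, h'⟩ ⟨w', k, k'⟩
      exact ⟨w + w', by simp [h, k], by simp [h', k']⟩
    have hsmul : ∀ (b : B) x,
      (∃ w : RingHom.ker μ, (RingHom.ker μ).toCotangent w = α₀ x ∧ δ w = x) →
      (∃ w : RingHom.ker μ, (RingHom.ker μ).toCotangent w = α₀ (b • x) ∧ δ w = b • x) := by
      rintro b x ⟨w, h, h'⟩
      refine ⟨ι o b • w, by simp [h, hsm], ?_⟩
      simp [hδ, h', hμι, RingHom.mem_ker.1 w.2]
    have h0 : ∃ w : RingHom.ker μ, (RingHom.ker μ).toCotangent w = α₀ 0 ∧ δ w = 0 :=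
      ⟨0, by simp, by simp⟩
    intro x
    induction x using TensorProduct.induction_on with
    | zero => exact h0
    | add x y hx hy => exact hadd x y hx hy
    | tmul ω v =>
      have hω : ω ∈ Submodule.span B (Set.range (KaehlerDifferential.D A B)) := by
        rw [KaehlerDifferential.span_range_derivation]; trivial
      induction hω using Submodule.span_induction with
      | zero => rw [TensorProduct.zero_tmul]; exact h0
      | add x y _ _ hx hy => rw [TensorProduct.add_tmul]; exact hadd _ _ hx hy
      | smul b x _ hx => rw [← TensorProduct.smul_tmul']; exact hsmul _ _ hx
      | mem x hx =>
        obtain ⟨b, rfl⟩ := hx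
        have hk : ∀ i, ι i b - ι o b ∈ RingHom.ker μ := fun i => by
          simp [RingHom.mem_ker, hμι]
        refine ⟨∑ i, ι o ((v : Fin l → B) i) • ⟨_, hk i⟩, ?_, ?_⟩
        · rw [map_sum, hα]
          refine Finset.sum_congr rfl fun i _ => ?_
          rw [map_smul, ← hsm, hew (ι i b) ⟨_, hk i⟩ (by simp [hμι])]
        · simp only [Submodule.coe_sum, Submodule.coe_smul, map_sum, smul_eq_mul, hδ, hμι, map_sub,
            hδ1, sub_self, zero_smul, add_zero, sub_zero]
          have : ∀ i, δ (ι i b) = KaehlerDifferential.D A B b ⊗ₜ[B] ⟨_, hvi i⟩ :=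
            fun i => hδι i b ⟨_, hvi i⟩ rfl
          simp only [this, ← TensorProduct.tmul_smul, ← TensorProduct.tmul_sum]
          congr 1
          ext j
          have := (hH v).1 v.2
          simp [mul_sub, Finset.sum_sub_distrib, Pi.single_apply, this]
  have hinj : Function.Injective α₀ := by
    rw [injective_iff_map_eq_zero]
    intro x hx
    obtain ⟨w, h, h'⟩ := hlift x
    rw [hx, Ideal.toCotangent_eq_zero] at h
    rw [← h', hδ2 _ h]
  have hbij : Function.Bijective α₀ := ⟨hinj, hsurj⟩
  refine ⟨LinearEquiv.ofBijective α₀ hbij, ?_⟩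
  intro b v w hw
  rw [LinearEquiv.ofBijective_apply, hα]
  refine Finset.sum_congr rfl fun i _ => ?_
  rw [hew (ι i b) (w i) (by rw [hw, hμι])]

theorem exists_delta {A B M : Type u} [CommRing A] [CommRing B] [Algebra A B] [AddCommGroup M]
    [Module B M] [Module A M] [IsScalarTower A B M] {l : ℕ}
    (μ : (⨂[A] _ : Fin l, B) →ₐ[A] B)
    (hμ : ∀ b : Fin l → B, μ (PiTensorProduct.tprod A b) = ∏ i, b i)
    (d : Fin l → Derivation A B M) :
    ∃ δ : (⨂[A] _ : Fin l, B) →ₗ[A] M,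
      (∀ s t, δ (s * t) = μ s • δ t + μ t • δ s) ∧
      ∀ i b, δ (PiTensorProduct.tprod A (Function.update (fun _ => (1 : B)) i b)) = d i b := by
  let _ : Module Bᵐᵒᵖ M := Module.compHom _ ((RingHom.id B).fromOpposite mul_comm)
  have : IsCentralScalar B M := ⟨fun _ _ => rfl⟩
  let _ : Module Aᵐᵒᵖ M := Module.compHom _ ((RingHom.id A).fromOpposite mul_comm)
  have : IsCentralScalar A M := ⟨fun _ _ => rfl⟩
  have : IsScalarTower A Bᵐᵒᵖ M := ⟨fun a b x => by
    induction b using MulOpposite.rec'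
    rw [← MulOpposite.op_smul, op_smul_eq_smul, op_smul_eq_smul, smul_assoc]⟩
  let ψ : Fin l → (B →ₐ[A] TrivSqZeroExt B M) := fun i =>
    AlgHom.ofLinearMap
      { toFun := fun b => TrivSqZeroExt.inl b + TrivSqZeroExt.inr (d i b)
        map_add' := fun a b => by ext <;> simp
        map_smul' := fun a b => by ext <;> simp }
      (by ext <;> simp)
      (fun a b => by ext <;> simp)
  have hψ : ∀ i b, ψ i b = TrivSqZeroExt.inl b + TrivSqZeroExt.inr (d i b) := fun i b => rfl
  let φ : (⨂[A] _ : Fin l, B) →ₐ[A] TrivSqZeroExt B M :=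
    PiTensorProduct.liftAlgHom
      ((MultilinearMap.mkPiAlgebra A (Fin l) (TrivSqZeroExt B M)).compLinearMap
        (fun i => (ψ i).toLinearMap)) (by simp) (fun x y => by simp [Finset.prod_mul_distrib])
  have hφ : ∀ b, φ (PiTensorProduct.tprod A b) = ∏ i, ψ i (b i) := fun b => by
    simp [φ, PiTensorProduct.liftAlgHom]
  have hfst : ∀ t, (φ t).fst = μ t := by
    intro t
    induction t using PiTensorProduct.induction_on with
    | smul_tprod r f =>
      rw [map_smul, map_smul, TrivSqZeroExt.fst_smul, hφ, hμ]
      congr 1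
      rw [← TrivSqZeroExt.fstHom_apply (S := A), map_prod]
      simp [hψ]
    | add x y hx hy => simp [hx, hy]
  refine ⟨{ toFun := fun t => (φ t).snd, map_add' := by simp, map_smul' := by simp }, ?_, ?_⟩
  · intro s t
    simp [hfst]
  · intro i b
    simp only [LinearMap.coe_mk, AddHom.coe_mk, hφ]
    rw [Finset.prod_eq_single i]
    · simp [hψ]
    · intro j _ hj
      simp [Function.update_of_ne hj]
    · simp

theorem core_equivariant {A B T : Type u} [CommRing A] [CommRing B] [Algebra A B] [CommRing T]
    [Algebra A T] {l : ℕ}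
    (μ : T →ₐ[A] B) (ι : Fin l → (B →ₐ[A] T)) (o : Fin l) (hμι : ∀ i b, μ (ι i b) = b)
    [Module B (RingHom.ker μ).Cotangent]
    (hsm : ∀ (b : B) (x : (RingHom.ker μ).Cotangent), b • x = ι o b • x)
    (σ : Equiv.Perm (Fin l)) (s : T →ₐ[A] T) (hs : ∀ i b, s (ι i b) = ι (σ i) b)
    (hμs : ∀ t, μ (s t) = μ t) (b : B) (v : Fin l → B) (hv : ∑ i, v i = 0)
    (t : Fin l → RingHom.ker μ) (ht : ∀ i, (t i : T) = ι i b - ι o b)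
    (w w' : RingHom.ker μ) (hw' : (w' : T) = s w)
    (h : ∑ i, v i • (RingHom.ker μ).toCotangent (t i) = (RingHom.ker μ).toCotangent w) :
    ∑ i, v (σ⁻¹ i) • (RingHom.ker μ).toCotangent (t i) = (RingHom.ker μ).toCotangent w' := by
  obtain ⟨h1, -⟩ := core_e μ (ι o) (hμι o) hsm
  have hle : RingHom.ker μ ≤ (RingHom.ker μ).comap s := fun x hx => by
    rw [Ideal.mem_comap, RingHom.mem_ker, hμs]; exact hx
  have h2 := congrArg (Ideal.mapCotangent (RingHom.ker μ) (RingHom.ker μ) s hle) h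
  have hm : ∀ (c : B) i, Ideal.mapCotangent (RingHom.ker μ) (RingHom.ker μ) s hle
      (c • (RingHom.ker μ).toCotangent (t i)) =
      c • (RingHom.ker μ).toCotangent (t (σ i)) - c • (RingHom.ker μ).toCotangent (t (σ o)) := by
    intro c i
    rw [hsm, ← map_smul, Ideal.mapCotangent_toCotangent, ← smul_sub, ← map_sub]
    have : (⟨s (ι o c • t i : RingHom.ker μ), hle (ι o c • t i : RingHom.ker μ).2⟩ :
        RingHom.ker μ) = ι (σ o) c • (t (σ i) - t (σ o)) := by
      ext; simp [ht, hs]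
    rw [this, map_smul, h1, hμι]
  rw [map_sum, Ideal.mapCotangent_toCotangent] at h2
  simp only [hm, Finset.sum_sub_distrib, ← Finset.sum_smul, hv, zero_smul, sub_zero] at h2
  rw [← Equiv.sum_comp σ]
  have h3 : ∀ i, σ⁻¹ (σ i) = i := fun i => σ.symm_apply_apply i
  simp only [h3]
  rw [h2]
  congr 1; ext; exact hw'.symm
end

open scoped TensorProduct in
set_option synthInstance.maxHeartbeats 400000 in
set_option maxHeartbeats 1000000 in
/-- Affine form of Lemma 3.5: for a smooth `A`-algebra `B` and `l ≥ 1`, let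
`T = B^{⊗_A l}`, `μ : T → B` the multiplication map, `I = ker μ`, and
`H = ker(Σ : B^l → B)`.  Then the `B`-linear map
`α : Ω_{B/A} ⊗_B H → I/I²` with `α(db ⊗ (eᵢ − eᵢ₊₁)) = [ιᵢ(b) − ιᵢ₊₁(b)]` is a
well-defined `B`-linear isomorphism, equivariant for the `Σ_l`-actions (permuting
tensor factors of `T` and coordinates of `H`, trivially on `Ω_{B/A}`). -/
theorem stmt_5 (A B : Type u) [CommRing A] [CommRing B] [Algebra A B]
    [Algebra.Smooth A B] (l : ℕ) (hl : 1 ≤ l)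
    (μ : (⨂[A] _ : Fin l, B) →ₐ[A] B)
    (hμ : ∀ b : Fin l → B, μ (PiTensorProduct.tprod A b) = ∏ i, b i)
    (ιf : Fin l → (B →ₐ[A] ⨂[A] _ : Fin l, B))
    (hιf : ∀ (i : Fin l) (b : B),
      ιf i b = PiTensorProduct.tprod A (Function.update (fun _ => (1 : B)) i b))
    (H : Submodule B (Fin l → B))
    (hH : ∀ v : Fin l → B, v ∈ H ↔ ∑ i, v i = 0) :
    letI : Module B (RingHom.ker μ).Cotangent :=
      Module.compHom _ (ιf ⟨0, by omega⟩).toRingHom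
    ∃ α : ((Ω[B⁄A]) ⊗[B] ↥H) ≃ₗ[B] (RingHom.ker μ).Cotangent,
      (∀ (b : B) (i : Fin (l - 1)) (v : ↥H) (w : ↥(RingHom.ker μ)),
        (v : Fin l → B) =
          (Pi.single (Fin.cast (by omega : l - 1 + 1 = l) i.castSucc) (1 : B) : Fin l → B) -
            (Pi.single (Fin.cast (by omega : l - 1 + 1 = l) i.succ) (1 : B) : Fin l → B) →
        (w : ⨂[A] _ : Fin l, B) =
          ιf (Fin.cast (by omega : l - 1 + 1 = l) i.castSucc) b -
            ιf (Fin.cast (by omega : l - 1 + 1 = l) i.succ) b →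
        α (KaehlerDifferential.D A B b ⊗ₜ[B] v) = (RingHom.ker μ).toCotangent w) ∧
      ∀ (σ : Equiv.Perm (Fin l)) (b : B) (v v' : ↥H) (w w' : ↥(RingHom.ker μ)),
        (v' : Fin l → B) = (v : Fin l → B) ∘ ⇑σ⁻¹ →
        (w' : ⨂[A] _ : Fin l, B) =
          PiTensorProduct.reindex A (fun _ => B) σ (w : ⨂[A] _ : Fin l, B) →
        α (KaehlerDifferential.D A B b ⊗ₜ[B] v) = (RingHom.ker μ).toCotangent w →
        α (KaehlerDifferential.D A B b ⊗ₜ[B] v') = (RingHom.ker μ).toCotangent w' := by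
  letI inst : Module B (RingHom.ker μ).Cotangent :=
    Module.compHom _ (ιf ⟨0, by omega⟩).toRingHom
  have hμι : ∀ i b, μ (ιf i b) = b := by
    intro i b
    rw [hιf, hμ, Finset.prod_eq_single i]
    · simp
    · intro j _ hj
      simp [Function.update_of_ne hj]
    · simp
  have htp : ∀ b : Fin l → B, PiTensorProduct.tprod A b = ∏ i, ιf i (b i) := by
    intro b
    simp only [hιf]
    rw [← PiTensorProduct.tprod_prod]
    congr 1
    ext j
    rw [Finset.prod_apply, Finset.prod_eq_single j]
    · simp
    · intro k _ hk
      simp [Function.update_of_ne hk.symm]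
    · simp
  have hgen : Algebra.adjoin A (⋃ i, Set.range (ιf i)) = ⊤ := by
    rw [eq_top_iff]
    rintro t -
    induction t using PiTensorProduct.induction_on with
    | smul_tprod r f =>
      rw [htp]
      refine Subalgebra.smul_mem _ (Subalgebra.prod_mem _ fun i _ => Algebra.subset_adjoin ?_) r
      exact Set.mem_iUnion.2 ⟨i, f i, rfl⟩
    | add x y hx hy => exact add_mem hx hy
  set o : Fin l := ⟨0, by omega⟩ with ho
  have hsm : ∀ (b : B) (x : (RingHom.ker μ).Cotangent), b • x = ιf o b • x := fun _ _ => rfl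
  have hvi : ∀ i : Fin l, (Pi.single i 1 - Pi.single o 1 : Fin l → B) ∈ H := by
    intro i; rw [hH]; simp
  obtain ⟨δ, hδ, hδι⟩ := exists_delta (M := (Ω[B⁄A]) ⊗[B] ↥H) μ hμ (fun i =>
    LinearMap.compDer ((TensorProduct.mk B (Ω[B⁄A]) H).flip ⟨_, hvi i⟩) (KaehlerDifferential.D A B))
  obtain ⟨α, hα⟩ := core_iso μ ιf o hμι H hH hsm hgen δ hδ (by
    intro i b v hv
    rw [hιf, hδι]
    have : v = ⟨_, hvi i⟩ := Subtype.ext hv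
    rw [this]; rfl)
  have hk : ∀ b i, ιf i b - ιf o b ∈ RingHom.ker μ := fun b i => by
    simp [RingHom.mem_ker, hμι]
  refine ⟨α, ?_, ?_⟩
  · intro b i v w hv hw
    rw [hα b v (fun i => ⟨_, hk b i⟩) (fun i => rfl), hv]
    simp only [Pi.sub_apply, sub_smul, Finset.sum_sub_distrib, Pi.single_apply, ite_smul, one_smul,
      zero_smul, Finset.sum_ite_eq', Finset.mem_univ, if_true]
    rw [← map_sub]
    congr 1; ext; simp [hw]
  · intro σ b v v' w w' hv' hw' h
    rw [hα b v (fun i => ⟨_, hk b i⟩) (fun i => rfl)] at h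
    rw [hα b v' (fun i => ⟨_, hk b i⟩) (fun i => rfl), hv']
    let s : (⨂[A] _ : Fin l, B) →ₐ[A] (⨂[A] _ : Fin l, B) :=
      AlgHom.ofLinearMap (PiTensorProduct.reindex A (fun _ => B) σ).toLinearMap
        (by
          rw [PiTensorProduct.one_def]
          exact PiTensorProduct.reindex_tprod σ _)
        (by
          intro x y
          induction x using PiTensorProduct.induction_on with
          | add x x' hx hx' => rw [add_mul, map_add, map_add, add_mul, hx, hx']
          | smul_tprod r f =>
            rw [smul_mul_assoc, map_smul, map_smul, smul_mul_assoc]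
            congr 1
            induction y using PiTensorProduct.induction_on with
            | add x x' hx hx' => rw [mul_add, map_add, map_add, mul_add, hx, hx']
            | smul_tprod r g =>
              rw [mul_smul_comm, map_smul, map_smul, mul_smul_comm]
              congr 1
              rw [PiTensorProduct.tprod_mul_tprod]
              simp only [LinearEquiv.coe_coe]
              erw [PiTensorProduct.reindex_tprod, PiTensorProduct.reindex_tprod,
                PiTensorProduct.reindex_tprod, PiTensorProduct.tprod_mul_tprod]
              rfl)
    have hsr : ∀ t, s t = PiTensorProduct.reindex A (fun _ => B) σ t := fun t => rfl
    have hst : ∀ f : Fin l → B, s (PiTensorProduct.tprod A f) =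
        PiTensorProduct.tprod A (fun i => f (σ.symm i)) := fun f =>
      PiTensorProduct.reindex_tprod σ f
    refine core_equivariant μ ιf o hμι hsm σ s ?_ ?_ b v ((hH v).1 v.2)
      (fun i => ⟨_, hk b i⟩) (fun i => rfl) w w' hw' h
    · intro i c
      rw [hιf, hιf, hst]
      congr 1
      ext j
      simp [Function.update_apply, Equiv.symm_apply_eq]
    · intro t
      induction t using PiTensorProduct.induction_on with
      | smul_tprod r f =>
        rw [map_smul, map_smul, map_smul, hst, hμ, hμ, Equiv.prod_comp σ.symm]
      | add x y hx hy => rw [map_add, map_add, map_add, hx, hy]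
end

section
/- Let A be a noetherian local ring, let I ⊆ A be an ideal generated by a regular sequence, let F be a finite free A-module, and let ε : F → A be an A-linear map whose image is I. Let E be the kernel of the induced A/I-linear map F/IF → I/I². Then for every i ≥ 0, the i-th homology of the Koszul complex of ε, namely ker(d_i : Λ^i F → Λ^{i−1} F) / im(d_{i+1} : Λ^{i+1} F → Λ^i F), is isomorphic as an A-module to the exterior power Λ^i_{A/I}(E) of the A/I-module E, regarded as an A-module via A → A/I. -/
open CliffordAlgebra in
/-- contraction -/
noncomputable def kC {A F : Type*} [CommRing A] [AddCommGroup F] [Module A F]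
    (φ : F →ₗ[A] A) : ExteriorAlgebra A F →ₗ[A] ExteriorAlgebra A F :=
  contractLeft (Q := (0 : QuadraticForm A F)) φ

section KC
variable {A F : Type*} [CommRing A] [AddCommGroup F] [Module A F]

lemma kC_mul (φ : F →ₗ[A] A) (v : F) (x : ExteriorAlgebra A F) :
    kC φ (ExteriorAlgebra.ι A v * x) = φ v • x - ExteriorAlgebra.ι A v * kC φ x :=
  CliffordAlgebra.contractLeft_ι_mul φ v x

lemma kC_algebraMap (φ : F →ₗ[A] A) (r : A) :
    kC φ (algebraMap A (ExteriorAlgebra A F) r) = 0 :=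
  CliffordAlgebra.contractLeft_algebraMap _ φ r

lemma kC_kC (φ : F →ₗ[A] A) (x : ExteriorAlgebra A F) : kC φ (kC φ x) = 0 :=
  CliffordAlgebra.contractLeft_contractLeft φ x

lemma kC_comm (φ ψ : F →ₗ[A] A) (x : ExteriorAlgebra A F) :
    kC φ (kC ψ x) = - kC ψ (kC φ x) :=
  CliffordAlgebra.contractLeft_comm φ ψ x

lemma kC_sum {n : ℕ} (a : Fin n → A) (φ : Fin n → F →ₗ[A] A) (x : ExteriorAlgebra A F) :
    kC (∑ i, a i • φ i) x = ∑ i, a i • kC (φ i) x := by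
  unfold kC
  rw [map_sum, LinearMap.sum_apply]
  simp only [map_smul, LinearMap.smul_apply]

lemma kC_zero (x : ExteriorAlgebra A F) : kC (0 : F →ₗ[A] A) x = 0 := by
  unfold kC
  rw [map_zero, LinearMap.zero_apply]

lemma kInd {P : ExteriorAlgebra A F → Prop} (x : ExteriorAlgebra A F)
    (h0 : ∀ r, P (algebraMap A _ r)) (ha : ∀ x y, P x → P y → P (x + y))
    (hm : ∀ x v, P x → P (ExteriorAlgebra.ι A v * x)) : P x :=
  CliffordAlgebra.left_induction (0 : QuadraticForm A F) (P := P) h0 ha hm x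

lemma kC_map (φ : F →ₗ[A] A) (f : F →ₗ[A] F) (x : ExteriorAlgebra A F) :
    kC φ (ExteriorAlgebra.map f x) = ExteriorAlgebra.map f (kC (φ ∘ₗ f) x) := by
  induction x using kInd with
  | h0 r => rw [AlgHom.commutes, kC_algebraMap, kC_algebraMap, map_zero]
  | ha x y hx hy => simp only [map_add, hx, hy]
  | hm x v hx =>
    rw [map_mul, ExteriorAlgebra.map_apply_ι, kC_mul, kC_mul, hx, map_sub, map_mul,
      ExteriorAlgebra.map_apply_ι, map_smul]
    rfl

lemma kMap_elem (φ : F →ₗ[A] A) (e : F) (x : ExteriorAlgebra A F) :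
    ExteriorAlgebra.map (LinearMap.id - φ.smulRight e) x = x - ExteriorAlgebra.ι A e * kC φ x := by
  induction x using kInd with
  | h0 r => rw [AlgHom.commutes, kC_algebraMap, mul_zero, sub_zero]
  | ha x y hx hy => simp only [map_add, hx, hy, mul_add]; abel
  | hm x v hx =>
    have h1 : ExteriorAlgebra.ι A e * ExteriorAlgebra.ι A v
        = - (ExteriorAlgebra.ι A v * ExteriorAlgebra.ι A e) := by
      rw [eq_neg_iff_add_eq_zero]; exact ExteriorAlgebra.ι_add_mul_swap e v
    rw [map_mul, ExteriorAlgebra.map_apply_ι, hx, kC_mul]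
    simp only [LinearMap.sub_apply, LinearMap.id_apply, LinearMap.smulRight_apply, map_sub,
      map_smul, sub_mul, mul_sub, mul_smul_comm, smul_mul_assoc, ← mul_assoc, h1,
      ExteriorAlgebra.ι_sq_zero, neg_mul, zero_mul, smul_zero]
    abel

/-- projection along the `e i` -/
noncomputable def kP {n : ℕ} (s : Finset (Fin n)) (e : Fin n → F) (φ : Fin n → F →ₗ[A] A) :
    F →ₗ[A] F := LinearMap.id - ∑ i ∈ s, (φ i).smulRight (e i)

lemma kP_apply {n : ℕ} (s : Finset (Fin n)) (e : Fin n → F) (φ : Fin n → F →ₗ[A] A) (v : F) :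
    kP s e φ v = v - ∑ i ∈ s, φ i v • e i := by
  simp [kP, LinearMap.sum_apply]

lemma kP_fix {n : ℕ} (s : Finset (Fin n)) (e : Fin n → F) (φ : Fin n → F →ₗ[A] A)
    (he : ∀ i j, φ i (e j) = if i = j then 1 else 0) (x : ExteriorAlgebra A F)
    (hx : ∀ i ∈ s, kC (φ i) x = 0) : ExteriorAlgebra.map (kP s e φ) x = x := by
  induction s using Finset.induction_on with
  | empty => simp [kP]
  | insert i s hi ih =>
    have h1 : kP (insert i s) e φ = kP s e φ ∘ₗ (LinearMap.id - (φ i).smulRight (e i)) := by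
      ext v
      simp only [kP_apply, LinearMap.comp_apply, LinearMap.sub_apply, LinearMap.id_apply,
        LinearMap.smulRight_apply, map_sub, map_smul, Finset.sum_insert hi, he]
      have : ∑ x ∈ s, (if x = i then (1:A) else 0) • e x = 0 := by
        refine Finset.sum_eq_zero fun j hj => ?_
        rw [if_neg (by rintro rfl; exact hi hj)]; simp
      rw [this, sub_zero]; abel
    rw [h1, ← ExteriorAlgebra.map_comp_map, AlgHom.comp_apply, kMap_elem, hx i (by simp), mul_zero,
      sub_zero]
    exact ih fun j hj => hx j (by simp [hj])

lemma kSpan {N : Type*} [AddCommGroup N] [Module A N] {n : ℕ} (a : Fin n → A) (S : Set (Fin n))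
    (x : N) (hx : x ∈ Ideal.span (a '' S) • (⊤ : Submodule A N)) :
    ∃ w : Fin n → N, (∀ i, i ∉ S → w i = 0) ∧ x = ∑ i, a i • w i := by
  classical
  induction hx using Submodule.smul_induction_on' with
  | smul r hr m hm =>
    clear hm
    induction hr using Submodule.span_induction with
    | mem r hr =>
      obtain ⟨i, hi, rfl⟩ := hr
      refine ⟨Pi.single i m, fun j hj => ?_, ?_⟩
      · rw [Pi.single_eq_of_ne]; rintro rfl; exact hj hi
      · rw [Finset.sum_eq_single i]
        · simp
        · intro j _ hj; simp [hj]
        · simp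
    | zero => exact ⟨0, by simp, by simp⟩
    | add r s _ _ h1 h2 =>
      obtain ⟨w1, h1, h1'⟩ := h1
      obtain ⟨w2, h2, h2'⟩ := h2
      exact ⟨w1 + w2, fun i hi => by simp [h1 i hi, h2 i hi], by
        simp [add_smul, h1', h2', Finset.sum_add_distrib]⟩
    | smul c r _ h1 =>
      obtain ⟨w1, h1, h1'⟩ := h1
      exact ⟨c • w1, fun i hi => by simp [h1 i hi], by
        simp only [smul_eq_mul, mul_smul, h1', Finset.smul_sum, Pi.smul_apply]
        exact Finset.sum_congr rfl fun i _ => smul_comm _ _ _⟩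
  | add x hx y hy h1 h2 =>
    obtain ⟨w1, h1, h1'⟩ := h1
    obtain ⟨w2, h2, h2'⟩ := h2
    exact ⟨w1 + w2, fun i hi => by simp [h1 i hi, h2 i hi], by
        simp [h1', h2', Finset.sum_add_distrib]⟩

lemma kSpan' {N : Type*} [AddCommGroup N] [Module A N] {n : ℕ} (a : Fin n → A) (S : Set (Fin n))
    (w : Fin n → N) (h : ∀ i, i ∉ S → w i = 0) :
    ∑ i, a i • w i ∈ Ideal.span (a '' S) • (⊤ : Submodule A N) := by
  refine Submodule.sum_mem _ fun i _ => ?_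
  by_cases hi : i ∈ S
  · exact Submodule.smul_mem_smul (Ideal.subset_span ⟨i, hi, rfl⟩) trivial
  · simp [h i hi]

lemma kFree {N : Type*} [AddCommGroup N] [Module A N] {ι : Type*}
    (b : Module.Basis ι A N) (J : Ideal A) (r : A)
    (hr : ∀ x, r * x ∈ J → x ∈ J) (x : N) (hx : r • x ∈ J • (⊤ : Submodule A N)) :
    x ∈ J • (⊤ : Submodule A N) := by
  have h1 : ∀ y ∈ J • (⊤ : Submodule A N), ∀ s, b.coord s y ∈ J := by
    intro y hy s
    induction hy using Submodule.smul_induction_on' with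
    | smul r hr m hm => rw [map_smul]; exact J.mul_mem_right _ hr
    | add x hx y hy h1 h2 => rw [map_add]; exact J.add_mem h1 h2
  rw [← b.linearCombination_repr x, Finsupp.linearCombination_apply]
  refine Submodule.sum_mem _ fun s _ => Submodule.smul_mem_smul (hr _ ?_) trivial
  simpa using h1 _ hx s

lemma kReg {n : ℕ} (a : Fin n → A)
    (hreg : ∀ (kk : Fin n) (x : A), a kk * x ∈ Ideal.span (a '' {j : Fin n | j < kk}) →
        x ∈ Ideal.span (a '' {j : Fin n | j < kk})) (k : ℕ) (hk : k ≤ n) :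
    ∀ c : Fin n → A, (∀ i : Fin n, k ≤ i → c i = 0) → ∑ i, a i * c i = 0 →
      ∀ i, c i ∈ Ideal.span (Set.range a) := by
  induction k with
  | zero => intro c hc _ i; rw [hc i (Nat.zero_le _)]; exact Ideal.zero_mem _
  | succ k ih =>
    intro c hc h
    set K : Fin n := ⟨k, hk⟩ with hK
    have hlt : ∀ i : Fin n, i ∉ {j : Fin n | j < K} → i ≠ K → c i = 0 := by
      intro i hi hiK
      apply hc
      simp only [Set.mem_ofPred_eq, Fin.lt_def, hK, not_lt, ne_eq, Fin.ext_iff] at hi hiK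
      omega
    have h2 : a K * c K = ∑ i, a i • (if i = K then 0 else - c i) := by
      have : ∑ i, a i • (if i = K then 0 else - c i) + ∑ i, a i * c i = a K * c K := by
        rw [← Finset.sum_add_distrib, Finset.sum_eq_single K]
        · simp
        · intro j _ hj; simp [hj]
        · simp
      rw [← this, h, add_zero]
    have h3 : c K ∈ Ideal.span (a '' {j : Fin n | j < K}) := by
      apply hreg
      rw [h2]
      have := kSpan' a {j : Fin n | j < K} (fun i => if i = K then 0 else - c i) (by
        intro i hi
        by_cases hiK : i = K
        · simp [hiK]
        · simp [hiK, hlt i hi hiK])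
      simpa using this
    obtain ⟨b, hb, hb'⟩ := kSpan (N := A) a {j : Fin n | j < K} (c K) (by simpa using h3)
    have h4 := ih (by omega) (fun i => (if i = K then 0 else c i) + a K * b i) (by
      intro i hi
      have hi' : i ∉ {j : Fin n | j < K} := by
        simp only [Set.mem_ofPred_eq, Fin.lt_def, hK]; omega
      simp only [hb i hi', mul_zero, add_zero]
      by_cases hiK : i = K
      · simp [hiK]
      · simp [hiK, hlt i hi' hiK]) (by
      have e1 : ∑ i, a i * ((if i = K then 0 else c i) + a K * b i)
          = -(∑ i, a i • (if i = K then 0 else - c i)) + a K * ∑ i, a i • b i := by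
        rw [Finset.mul_sum, ← Finset.sum_neg_distrib, ← Finset.sum_add_distrib]
        refine Finset.sum_congr rfl fun i _ => ?_
        by_cases hiK : i = K
        · simp [hiK]
        · simp [hiK]; ring
      rw [e1, ← h2, ← hb']; ring)
    intro i
    by_cases hiK : i = K
    · rw [hiK]; exact Ideal.span_mono (Set.image_subset_range _ _) h3
    · have := h4 i
      simp only [hiK, if_false] at this
      have h5 : a K * b i ∈ Ideal.span (Set.range a) :=
        Ideal.mul_mem_right _ _ (Ideal.subset_span ⟨K, rfl⟩)
      exact (Ideal.add_mem_iff_left _ h5).1 this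

lemma kAcyc {n : ℕ} (a : Fin n → A) {ι : Type*} (b : Module.Basis ι A (ExteriorAlgebra A F))
    (hreg : ∀ (kk : Fin n) (x : A), a kk * x ∈ Ideal.span (a '' {j : Fin n | j < kk}) →
        x ∈ Ideal.span (a '' {j : Fin n | j < kk}))
    (e : Fin n → F) (φ : Fin n → F →ₗ[A] A)
    (he : ∀ i j, φ i (e j) = if i = j then 1 else 0)
    (ε : F →ₗ[A] A) (hε : ε = ∑ i, a i • φ i)
    (ρ : ExteriorAlgebra A F →ₐ[A] ExteriorAlgebra A F)
    (hρ : ρ = ExteriorAlgebra.map (kP Finset.univ e φ))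
    (hρφ : ∀ i x, kC (φ i) (ρ x) = 0)
    (hρρ : ∀ x, ρ (ρ x) = ρ x)
    (hρe : ∀ i, ρ (ExteriorAlgebra.ι A (e i)) = 0)
    (hρε : ∀ x, kC ε (ρ x) = 0)
    (hεe : ∀ i, ε (e i) = a i)
    (k : ℕ) (hk : k ≤ n) :
    ∀ z, (∀ i : Fin n, k ≤ i → kC (φ i) z = 0) → kC ε z = 0 → ρ z = 0 →
      ∃ w, (∀ i : Fin n, k ≤ i → kC (φ i) w = 0) ∧ ρ w = 0 ∧ kC ε w = z := by
  induction k with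
  | zero =>
    intro z hz _ h2
    refine ⟨0, by simp, by simp, ?_⟩
    rw [map_zero, ← h2, hρ]
    exact kP_fix _ _ _ he _ fun i _ => hz i (Nat.zero_le _)
  | succ k ih =>
    intro z hz hd hr
    set K : Fin n := ⟨k, hk⟩ with hK
    have hcase : ∀ i : Fin n, k ≤ i → i = K ∨ k + 1 ≤ i := by
      intro i hi
      rw [Fin.ext_iff]; simp only [hK]; omega
    have hKne : ∀ i : Fin n, k + 1 ≤ i → i ≠ K := by
      intro i hi h; rw [h] at hi; simp [hK] at hi
    set E := ExteriorAlgebra.ι A (e K) with hE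
    set x := kC (φ K) z with hx
    set y := z - E * x with hy
    have Kx : ∀ i : Fin n, k ≤ i → kC (φ i) x = 0 := by
      intro i hi
      rcases hcase i hi with rfl | h
      · exact kC_kC _ _
      · rw [hx, kC_comm, hz i h, map_zero, neg_zero]
    have Ky : ∀ i : Fin n, k ≤ i → kC (φ i) y = 0 := by
      intro i hi
      rw [hy, map_sub, hE, kC_mul, Kx i hi, he, mul_zero, sub_zero]
      rcases hcase i hi with rfl | h
      · rw [if_pos rfl, one_smul, ← hx, sub_self]
      · rw [hz i h, if_neg (hKne i h), zero_smul, sub_zero]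
    have Dx : kC ε x = 0 := by rw [hx, kC_comm, hd, map_zero, neg_zero]
    have Dy : kC ε y = - (a K • x) := by
      rw [hy, map_sub, hd, hE, kC_mul, Dx, hεe]; simp
    have Ry : ρ y = 0 := by rw [hy, map_sub, hr, map_mul, hρe]; simp
    have h1 : a K • ρ x ∈ Ideal.span (a '' {j : Fin n | j < K}) •
        (⊤ : Submodule A (ExteriorAlgebra A F)) := by
      have : a K • ρ x = ∑ i, a i • (- ρ (kC (φ i) y)) := by
        have h := congrArg ρ Dy
        rw [hε, kC_sum, map_neg, map_smul, map_sum] at h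
        rw [← neg_inj, ← h, ← Finset.sum_neg_distrib]
        simp
      rw [this]
      apply kSpan'
      intro i hi
      rw [Ky, map_zero, neg_zero]
      simpa [hK, Fin.lt_def] using hi
    obtain ⟨w, hw, hw'⟩ := kSpan _ _ _ (kFree b _ _ (hreg K) _ h1)
    set u0 := ∑ i, ExteriorAlgebra.ι A (e i) * ρ (w i) with hu0
    have Ku0 : ∀ i : Fin n, k ≤ i → kC (φ i) u0 = 0 := by
      intro i hi
      rw [hu0, map_sum]
      refine Finset.sum_eq_zero fun j _ => ?_
      rw [kC_mul, hρφ, mul_zero, sub_zero, he]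
      split_ifs with h
      · subst h
        rw [hw, map_zero, smul_zero]
        simpa [hK, Fin.lt_def] using hi
      · simp
    have Du0 : kC ε u0 = ρ x := by
      rw [hu0, map_sum, ← hρρ x, hw', map_sum]
      refine Finset.sum_congr rfl fun i _ => ?_
      rw [kC_mul, hρε, hεe, mul_zero, sub_zero, map_smul]
    have Ru0 : ρ u0 = 0 := by
      rw [hu0, map_sum]
      refine Finset.sum_eq_zero fun j _ => ?_
      rw [map_mul, hρe, zero_mul]
    obtain ⟨u1, Ku1, Ru1, Du1⟩ := ih (by omega) (x - ρ x)
      (fun i hi => by rw [map_sub, Kx i hi, hρφ, sub_zero])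
      (by rw [map_sub, Dx, hρε, sub_zero]) (by rw [map_sub, hρρ, sub_self])
    set u := u0 + u1 with hu
    have Du : kC ε u = x := by rw [hu, map_add, Du0, Du1]; abel
    have Ku : ∀ i : Fin n, k ≤ i → kC (φ i) u = 0 := fun i hi => by
      rw [hu, map_add, Ku0 i hi, Ku1 i hi, add_zero]
    have Ru : ρ u = 0 := by rw [hu, map_add, Ru0, Ru1, add_zero]
    obtain ⟨w', Kw', Rw', Dw'⟩ := ih (by omega) (y + a K • u)
      (fun i hi => by rw [map_add, map_smul, Ky i hi, Ku i hi, smul_zero, add_zero])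
      (by rw [map_add, map_smul, Dy, Du]; abel) (by rw [map_add, map_smul, Ry, Ru]; simp)
    refine ⟨w' - E * u, fun i hi => ?_, ?_, ?_⟩
    · rw [map_sub, Kw' i (by omega), hE, kC_mul, Ku i (by omega), he, if_neg (hKne i hi)]
      simp
    · rw [map_sub, map_mul, Rw', Ru]; simp
    · rw [map_sub, Dw', hE, kC_mul, hεe, Du, ← hE, hy]; abel

end KC

section KC2
variable {A F : Type*} [CommRing A] [AddCommGroup F] [Module A F]

lemma kAdapt [IsLocalRing A] [Module.Free A F] {n : ℕ} (a : Fin n → A)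
    (hreg : ∀ (kk : Fin n) (x : A), a kk * x ∈ Ideal.span (a '' {j : Fin n | j < kk}) →
        x ∈ Ideal.span (a '' {j : Fin n | j < kk}))
    (hI : Ideal.span (Set.range a) ≠ ⊤)
    (ε : F →ₗ[A] A) (hε : LinearMap.range ε = Ideal.span (Set.range a)) :
    ∃ (e : Fin n → F) (φ : Fin n → F →ₗ[A] A),
      (∀ i j, φ i (e j) = if i = j then 1 else 0) ∧ ε = ∑ i, a i • φ i := by
  classical
  have h1 : ∀ i, ∃ v, ε v = a i := fun i => by
    have : a i ∈ LinearMap.range ε := by rw [hε]; exact Ideal.subset_span ⟨i, rfl⟩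
    exact this
  choose e hee using h1
  let b := Module.Free.chooseBasis A F
  have h2 : ∀ s, ∃ c : Fin n → A, ε (b s) = ∑ i, a i * c i := fun s => by
    have : ε (b s) ∈ Ideal.span (a '' Set.univ) • (⊤ : Submodule A A) := by
      rw [Set.image_univ, ← hε]
      simp
    obtain ⟨w, -, hw⟩ := kSpan _ _ _ this
    exact ⟨w, hw⟩
  choose c hc using h2
  let φ : Fin n → F →ₗ[A] A := fun i => b.constr A (fun s => c s i)
  have hφ : ε = ∑ i, a i • φ i := by
    refine b.ext fun s => ?_
    simp [φ, hc, LinearMap.sum_apply, Module.Basis.constr_basis]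
  let M : Matrix (Fin n) (Fin n) A := Matrix.of fun i j => φ i (e j)
  have haM : Matrix.vecMul a M = a := by
    ext j
    have := hee j
    rw [hφ] at this
    simpa [Matrix.vecMul, dotProduct, M, LinearMap.sum_apply] using this
  have hM : ∀ i j, M i j - (1 : Matrix (Fin n) (Fin n) A) i j ∈ Ideal.span (Set.range a) := by
    intro i j
    refine kReg a hreg n le_rfl (fun i => M i j - (1 : Matrix (Fin n) (Fin n) A) i j)
      (fun i hi => absurd i.2 (by omega)) ?_ i
    have h3 := congrFun haM j
    simp only [Matrix.vecMul, dotProduct] at h3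
    simp [mul_sub, Finset.sum_sub_distrib, h3, Matrix.one_apply]
  have hdet : IsUnit M.det := by
    by_contra h
    have h4 : Ideal.span (Set.range a) ≤ IsLocalRing.maximalIdeal A :=
      IsLocalRing.le_maximalIdeal hI
    have h5 : (IsLocalRing.residue A).mapMatrix M = 1 := by
      ext i j
      have h6 := h4 (hM i j)
      rw [← IsLocalRing.residue_eq_zero_iff, map_sub, sub_eq_zero] at h6
      rw [RingHom.mapMatrix_apply, Matrix.map_apply, h6, Matrix.one_apply, Matrix.one_apply]
      split_ifs <;> simp
    have h7 := RingHom.map_det (IsLocalRing.residue A) M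
    rw [h5, Matrix.det_one] at h7
    have h8 : M.det ∈ IsLocalRing.maximalIdeal A := (IsLocalRing.mem_maximalIdeal _).2 h
    rw [← IsLocalRing.residue_eq_zero_iff, h7] at h8
    exact one_ne_zero h8
  have haM' : Matrix.vecMul a M⁻¹ = a := by
    conv_lhs => rw [← haM]
    rw [Matrix.vecMul_vecMul, Matrix.mul_nonsing_inv _ hdet, Matrix.vecMul_one]
  refine ⟨e, fun i => ∑ j, M⁻¹ i j • φ j, fun i j => ?_, ?_⟩
  · have := congrFun (congrFun (Matrix.nonsing_inv_mul _ hdet) i) j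
    rw [Matrix.mul_apply, Matrix.one_apply] at this
    rw [← this]
    simp [M, LinearMap.sum_apply]
  · rw [hφ]
    simp only [Finset.smul_sum, smul_smul]
    rw [Finset.sum_comm]
    refine Finset.sum_congr rfl fun j _ => ?_
    rw [← Finset.sum_smul]
    congr 1
    exact (congrFun haM' j).symm

/-- cycles killed by the projection mod `I` are boundaries -/
lemma kMain [IsLocalRing A] [Module.Free A F] [Module.Finite A F] {n : ℕ} (a : Fin n → A)
    (hreg : ∀ (kk : Fin n) (x : A), a kk * x ∈ Ideal.span (a '' {j : Fin n | j < kk}) →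
        x ∈ Ideal.span (a '' {j : Fin n | j < kk}))
    (e : Fin n → F) (φ : Fin n → F →ₗ[A] A)
    (he : ∀ i j, φ i (e j) = if i = j then 1 else 0)
    (ε : F →ₗ[A] A) (hε : ε = ∑ i, a i • φ i) (z : ExteriorAlgebra A F) (hz : kC ε z = 0)
    (hz' : ExteriorAlgebra.map (kP Finset.univ e φ) z ∈
      Ideal.span (Set.range a) • (⊤ : Submodule A (ExteriorAlgebra A F))) :
    ∃ w, kC ε w = z := by
  classical
  obtain ⟨m, b⟩ : Σ m, Module.Basis (Fin m) A F := ⟨_, Module.finBasis A F⟩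
  set ρ := ExteriorAlgebra.map (kP Finset.univ e φ) with hρ
  have hφP : ∀ i, φ i ∘ₗ kP Finset.univ e φ = 0 := by
    intro i
    ext v
    simp [kP_apply, he]
  have hρφ : ∀ i x, kC (φ i) (ρ x) = 0 := fun i x => by
    rw [hρ, kC_map, hφP, kC_zero, map_zero]
  have hρρ : ∀ x, ρ (ρ x) = ρ x := fun x => kP_fix _ _ _ he _ fun i _ => hρφ i x
  have hρe : ∀ i, ρ (ExteriorAlgebra.ι A (e i)) = 0 := fun i => by
    rw [hρ, ExteriorAlgebra.map_apply_ι, kP_apply]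
    simp [he]
  have hρε : ∀ x, kC ε (ρ x) = 0 := fun x => by
    rw [hε, kC_sum]; simp [hρφ]
  have hεe : ∀ i, ε (e i) = a i := fun i => by
    rw [hε]; simp [LinearMap.sum_apply, he]
  obtain ⟨w, -, -, hw⟩ := kAcyc a b.ExteriorAlgebra hreg e φ he ε hε ρ hρ hρφ hρρ hρe hρε hεe n
    le_rfl (z - ρ z) (fun i hi => absurd i.2 (by omega)) (by rw [map_sub, hz, hρε, sub_zero])
    (by rw [map_sub, hρρ, sub_self])
  rw [← Set.image_univ] at hz'
  obtain ⟨c, -, hc⟩ := kSpan _ _ _ hz'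
  refine ⟨w + ∑ i, ExteriorAlgebra.ι A (e i) * ρ (c i), ?_⟩
  have : kC ε (∑ i, ExteriorAlgebra.ι A (e i) * ρ (c i)) = ρ z := by
    rw [map_sum, ← hρρ z, hc, map_sum]
    refine Finset.sum_congr rfl fun i _ => ?_
    rw [kC_mul, hρε, hεe, mul_zero, sub_zero, map_smul]
  rw [map_add, hw, this]; abel

lemma kC_ιMulti (ε : F →ₗ[A] A) (j : ℕ) (f : Fin (j + 1) → F) :
    kC ε (ExteriorAlgebra.ιMulti A (j + 1) f) = ∑ a : Fin (j + 1), ((-1 : A) ^ (a : ℕ) * ε (f a)) •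
          ExteriorAlgebra.ιMulti A j (fun m => f (a.succAbove m)) := by
  induction j with
  | zero =>
    rw [ExteriorAlgebra.ιMulti_succ_apply, kC_mul, ExteriorAlgebra.ιMulti_zero_apply]
    have : kC ε (1 : ExteriorAlgebra A F) = 0 := by
      rw [← map_one (algebraMap A _), kC_algebraMap]
    simp [this]
  | succ j ih =>
    rw [ExteriorAlgebra.ιMulti_succ_apply, kC_mul, ih, Fin.sum_univ_succ (n := j + 1)]
    simp only [Fin.val_zero, pow_zero, one_mul, Fin.succAbove_zero]
    rw [sub_eq_add_neg, Finset.mul_sum, ← Finset.sum_neg_distrib]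
    congr 1
    refine Finset.sum_congr rfl fun i _ => ?_
    rw [ExteriorAlgebra.ιMulti_succ_apply, mul_smul_comm, ← neg_smul]
    congr 1
    · simp [Matrix.vecTail, pow_succ]
    · simp [Matrix.vecTail, Function.comp_def]

end KC2

section KC3
open TensorProduct
variable {A F : Type*} [CommRing A] [AddCommGroup F] [Module A F]

lemma kTheta {B N : Type*} [CommRing B] [Algebra A B] [AddCommGroup N] [Module A N] [Module B N]
    [IsScalarTower A B N] (p : F →ₗ[A] N) :
    ∃ Θ : ExteriorAlgebra A F →ₐ[A] ExteriorAlgebra B N,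
      ∀ v, Θ (ExteriorAlgebra.ι A v) = ExteriorAlgebra.ι B (p v) :=
  ⟨ExteriorAlgebra.lift A ⟨((ExteriorAlgebra.ι B).restrictScalars A) ∘ₗ p,
    fun m => ExteriorAlgebra.ι_sq_zero (R := B) (p m)⟩,
    fun _ => ExteriorAlgebra.lift_ι_apply _ _ _ _⟩

lemma kTheta_multi {B N : Type*} [CommRing B] [Algebra A B] [AddCommGroup N] [Module A N]
    [Module B N] [IsScalarTower A B N] (p : F →ₗ[A] N)
    (Θ : ExteriorAlgebra A F →ₐ[A] ExteriorAlgebra B N)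
    (h : ∀ v, Θ (ExteriorAlgebra.ι A v) = ExteriorAlgebra.ι B (p v)) (j : ℕ) (f : Fin j → F) :
    Θ (ExteriorAlgebra.ιMulti A j f) = ExteriorAlgebra.ιMulti B j (fun i => p (f i)) := by
  rw [ExteriorAlgebra.ιMulti_apply, ExteriorAlgebra.ιMulti_apply, map_list_prod, List.map_ofFn]
  simp only [Function.comp_def, h]

lemma kPsi (I : Ideal A) (E : Submodule (A ⧸ I) (F ⧸ (I • (⊤ : Submodule A F)))) :
    ∃ ψ : ExteriorAlgebra (A ⧸ I) E →ₐ[A ⧸ I] (A ⧸ I) ⊗[A] ExteriorAlgebra A F,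
      ∀ (x : E) (v : F), (x : F ⧸ (I • (⊤ : Submodule A F))) = Submodule.Quotient.mk v →
        ψ (ExteriorAlgebra.ι (A ⧸ I) x) = 1 ⊗ₜ ExteriorAlgebra.ι A v := by
  let g0 : (F ⧸ (I • (⊤ : Submodule A F))) →ₗ[A] (A ⧸ I) ⊗[A] ExteriorAlgebra A F :=
    Submodule.liftQ _ (TensorProduct.mk A (A ⧸ I) (ExteriorAlgebra A F) 1 ∘ₗ ExteriorAlgebra.ι A)
      (by
        rw [Submodule.smul_le]
        intro r hr v _
        rw [LinearMap.mem_ker, map_smul, LinearMap.comp_apply, TensorProduct.mk_apply,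
          TensorProduct.smul_tmul', Algebra.smul_def, Ideal.Quotient.algebraMap_eq,
          Ideal.Quotient.eq_zero_iff_mem.2 hr, zero_mul, TensorProduct.zero_tmul])
  have hg0 : ∀ v : F, g0 (Submodule.Quotient.mk v) = 1 ⊗ₜ ExteriorAlgebra.ι A v := fun v => rfl
  let g := g0.extendScalarsOfSurjective (S := A ⧸ I) Ideal.Quotient.mk_surjective
  have hg : ∀ v : F, g (Submodule.Quotient.mk v) = 1 ⊗ₜ ExteriorAlgebra.ι A v := fun v => rfl
  refine ⟨ExteriorAlgebra.lift (A ⧸ I) ⟨g ∘ₗ E.subtype, fun m => ?_⟩, fun x v hxv => ?_⟩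
  · obtain ⟨v, hv⟩ := Submodule.Quotient.mk_surjective _ (m : F ⧸ (I • (⊤ : Submodule A F)))
    rw [LinearMap.comp_apply, Submodule.subtype_apply, ← hv, hg,
      Algebra.TensorProduct.tmul_mul_tmul, ExteriorAlgebra.ι_sq_zero, TensorProduct.tmul_zero]
  · rw [ExteriorAlgebra.lift_ι_apply, LinearMap.comp_apply, Submodule.subtype_apply, hxv, hg]

lemma kTens (I : Ideal A) {N : Type*} [AddCommGroup N] [Module A N] (x : N)
    (h : (1 : A ⧸ I) ⊗ₜ[A] x = 0) : x ∈ I • (⊤ : Submodule A N) := by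
  have := congrArg (TensorProduct.quotTensorEquivQuotSMul N I) h
  rw [← map_one (Ideal.Quotient.mk I), TensorProduct.quotTensorEquivQuotSMul_mk_tmul, one_smul,
    map_zero, Submodule.Quotient.mk_eq_zero] at this
  exact this

/-- from the vanishing of `Θ z` get `ρ z ∈ I ΛF` -/
lemma kKer (I : Ideal A) (E : Submodule (A ⧸ I) (F ⧸ (I • (⊤ : Submodule A F))))
    (f : F →ₗ[A] F) (p : F →ₗ[A] E)
    (hp : ∀ v, (p v : F ⧸ (I • (⊤ : Submodule A F))) = Submodule.Quotient.mk (f v))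
    (Θ : ExteriorAlgebra A F →ₐ[A] ExteriorAlgebra (A ⧸ I) E)
    (h : ∀ v, Θ (ExteriorAlgebra.ι A v) = ExteriorAlgebra.ι (A ⧸ I) (p v))
    (z : ExteriorAlgebra A F) (hz : Θ z = 0) :
    ExteriorAlgebra.map f z ∈ I • (⊤ : Submodule A (ExteriorAlgebra A F)) := by
  obtain ⟨ψ, hψ⟩ := kPsi I E
  have key : ∀ z, ψ (Θ z) = 1 ⊗ₜ ExteriorAlgebra.map f z := by
    intro z
    induction z using kInd with
    | h0 r =>
      rw [AlgHom.commutes, AlgHom.commutes,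
        IsScalarTower.algebraMap_apply A (A ⧸ I) (ExteriorAlgebra (A ⧸ I) E), AlgHom.commutes,
        Algebra.TensorProduct.algebraMap_apply, Algebra.algebraMap_eq_smul_one (A := ExteriorAlgebra A F),
        ← TensorProduct.smul_tmul, Algebra.smul_def r (1 : A ⧸ I), mul_one]
      rfl
    | ha x y hx hy => rw [map_add, map_add, map_add, hx, hy, TensorProduct.tmul_add]
    | hm x v hx =>
      rw [map_mul, map_mul, map_mul, hx, h, hψ _ _ (hp v), ExteriorAlgebra.map_apply_ι,
        Algebra.TensorProduct.tmul_mul_tmul, one_mul]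
  apply kTens
  rw [← key, hz, map_zero]

lemma kDeg (ε : F →ₗ[A] A) (j : ℕ) (x : ExteriorAlgebra A F) (hx : x ∈ ⋀[A]^(j + 1) F) :
    kC ε x ∈ ⋀[A]^j F := by
  rw [← ExteriorAlgebra.ιMulti_span_fixedDegree] at hx
  induction hx using Submodule.span_induction with
  | mem x hx =>
    obtain ⟨f, rfl⟩ := hx
    rw [kC_ιMulti]
    exact Submodule.sum_mem _ fun i _ => Submodule.smul_mem _ _
      (ExteriorAlgebra.ιMulti_range A j ⟨_, rfl⟩)
  | zero => rw [map_zero]; exact Submodule.zero_mem _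
  | add x y _ _ hx hy => rw [map_add]; exact Submodule.add_mem _ hx hy
  | smul r x _ hx => rw [map_smul]; exact Submodule.smul_mem _ _ hx

lemma kDeg0 (ε : F →ₗ[A] A) (x : ExteriorAlgebra A F) (hx : x ∈ ⋀[A]^0 F) :
    kC ε x = 0 := by
  rw [ExteriorAlgebra.exteriorPower, pow_zero, Submodule.mem_one] at hx
  obtain ⟨r, rfl⟩ := hx
  exact kC_algebraMap _ _

lemma kProj (ε : F →ₗ[A] A) (j : ℕ) (z w : ExteriorAlgebra A F) (hz : z ∈ ⋀[A]^j F)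
    (h : kC ε w = z) : ∃ w' ∈ ⋀[A]^(j + 1) F, kC ε w' = z := by
  have key : ∀ w, GradedRing.proj (fun i : ℕ ↦ ⋀[A]^i F) j (kC ε w)
      = kC ε (GradedRing.proj (fun i : ℕ ↦ ⋀[A]^i F) (j + 1) w) := by
    intro w
    induction w using DirectSum.Decomposition.inductionOn (fun i : ℕ ↦ ⋀[A]^i F) with
    | zero => simp
    | add x y hx hy => simp only [map_add, hx, hy]
    | @homogeneous i x =>
      simp only [GradedRing.proj_apply]
      rcases i with _ | i
      · rw [kDeg0 ε _ x.2, DirectSum.decompose_of_mem_ne (fun i : ℕ ↦ ⋀[A]^i F) x.2 (by omega)]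
        simp
      · by_cases hij : i = j
        · subst hij
          rw [DirectSum.decompose_of_mem_same (fun i : ℕ ↦ ⋀[A]^i F) x.2,
            DirectSum.decompose_of_mem_same (fun i : ℕ ↦ ⋀[A]^i F) (kDeg ε _ _ x.2)]
        · rw [DirectSum.decompose_of_mem_ne (fun i : ℕ ↦ ⋀[A]^i F) x.2 (by omega),
            DirectSum.decompose_of_mem_ne (fun i : ℕ ↦ ⋀[A]^i F) (kDeg ε _ _ x.2) hij, map_zero]
  refine ⟨GradedRing.proj (fun i : ℕ ↦ ⋀[A]^i F) (j + 1) w, ?_, ?_⟩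
  · rw [GradedRing.proj_apply]; exact SetLike.coe_mem _
  · rw [← key, h, GradedRing.proj_apply, DirectSum.decompose_of_mem_same (fun i : ℕ ↦ ⋀[A]^i F) hz]

end KC3


set_option synthInstance.maxHeartbeats 1000000 in
set_option maxHeartbeats 1000000 in
/-- Lemma 3.3 (stalkwise form): let `A` be a noetherian local ring, `I` an ideal
generated by a regular sequence, `F` a finite free `A`-module and `ε : F → A` a
linear map with image `I`.  Let `E` be the kernel of the induced `A/I`-linear map
`F/IF → I/I²`.  Then for every `j ≥ 0` the `j`-th homology
`ker(d_j)/im(d_{j+1})` of the Koszul complex of `ε` is isomorphic, as an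
`A`-module, to the exterior power `Λ^j_{A/I}(E)` regarded as an `A`-module via
`A → A/I` (the isomorphism being exhibited by a surjection from the cycles whose
kernel is exactly the boundaries). -/
theorem stmt_6 (A : Type*) [CommRing A] [IsNoetherianRing A] [IsLocalRing A]
    (I : Ideal A)
    (hreg : ∃ (n : ℕ) (a : Fin n → A),
      I = Ideal.span (Set.range a) ∧ I ≠ ⊤ ∧
      ∀ (kk : Fin n) (x : A), a kk * x ∈ Ideal.span (a '' {j : Fin n | j < kk}) →
        x ∈ Ideal.span (a '' {j : Fin n | j < kk}))
    (F : Type*) [AddCommGroup F] [Module A F] [Module.Finite A F] [Module.Free A F]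
    (ε : F →ₗ[A] A) (hε : LinearMap.range ε = I)
    (d : (j : ℕ) → (⋀[A]^j F →ₗ[A] ⋀[A]^(j - 1) F))
    (hd0 : d 0 = 0)
    (hd : ∀ (j : ℕ) (f : Fin (j + 1) → F) (x : ⋀[A]^(j + 1) F),
      (x : ExteriorAlgebra A F) = ExteriorAlgebra.ιMulti A (j + 1) f →
      (d (j + 1) x : ExteriorAlgebra A F) =
        ∑ a : Fin (j + 1), ((-1 : A) ^ (a : ℕ) * ε (f a)) •
          ExteriorAlgebra.ιMulti A j (fun m => f (a.succAbove m)))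
    (εbar : (F ⧸ (I • (⊤ : Submodule A F))) →ₗ[A ⧸ I] I.Cotangent)
    (hεbar : ∀ (v : F) (w : I), (w : A) = ε v →
      εbar (Submodule.Quotient.mk v) = I.toCotangent w)
    (E : Submodule (A ⧸ I) (F ⧸ (I • (⊤ : Submodule A F))))
    (hE : E = LinearMap.ker εbar) :
    ∀ j : ℕ,
      letI : Module A ↥(⋀[A ⧸ I]^j ↥E) := Module.compHom _ (Ideal.Quotient.mk I)
      ∃ θ : ↥(LinearMap.ker (d j)) →ₗ[A] ↥(⋀[A ⧸ I]^j ↥E),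
        Function.Surjective θ ∧
        LinearMap.ker θ =
          Submodule.comap (LinearMap.ker (d j)).subtype (LinearMap.range (d (j + 1))) := by
  obtain ⟨n, a, hIdef, hI, hreg⟩ := hreg
  obtain ⟨e, φ, he, hεφ⟩ := kAdapt a hreg (hIdef ▸ hI) ε (hε.trans hIdef)
  have haI : ∀ i, a i ∈ I := fun i => hIdef ▸ Ideal.subset_span ⟨i, rfl⟩
  have hεe : ∀ i, ε (e i) = a i := fun i => by
    rw [hεφ]; simp [LinearMap.sum_apply, he]
  have hεP : ∀ v, ε (kP Finset.univ e φ v) = 0 := fun v => by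
    rw [kP_apply, map_sub, map_sum]
    simp only [map_smul, hεe]
    rw [hεφ]
    simp [LinearMap.sum_apply, mul_comm]
  have hPE : ∀ v, (Submodule.Quotient.mk (kP Finset.univ e φ v) :
      F ⧸ (I • (⊤ : Submodule A F))) ∈ E := fun v => by
    rw [hE, LinearMap.mem_ker, hεbar _ 0 (by rw [hεP]; rfl), map_zero]
  let p : F →ₗ[A] E :=
    { toFun := fun v => ⟨Submodule.Quotient.mk (kP Finset.univ e φ v), hPE v⟩
      map_add' := fun v w => Subtype.ext (by simp)
      map_smul' := fun r v => Subtype.ext (by simp) }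
  have hp : ∀ v, (p v : F ⧸ (I • (⊤ : Submodule A F))) =
      Submodule.Quotient.mk (kP Finset.univ e φ v) := fun v => rfl
  have hpE : ∀ x : E, ∃ v, ε v = 0 ∧ p v = x := by
    intro x
    obtain ⟨v, hv⟩ := Submodule.Quotient.mk_surjective _ (x : F ⧸ (I • (⊤ : Submodule A F)))
    have hvE : εbar (Submodule.Quotient.mk v) = 0 := by
      have := x.2
      rw [← hv, hE, LinearMap.mem_ker] at this
      exact this
    have hεv : ε v ∈ I := hε ▸ LinearMap.mem_range_self ε v
    rw [hεbar v ⟨ε v, hεv⟩ rfl, Ideal.toCotangent_eq_zero] at hvE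
    simp only at hvE
    have hφv : ∀ i, φ i v ∈ I := by
      have h1 : (⟨ε v, hεv⟩ : I) ∈ Ideal.span (a '' Set.univ) • (⊤ : Submodule A I) := by
        rw [Set.image_univ, ← hIdef, Submodule.mem_smul_top_iff]
        simpa [pow_two] using hvE
      have h2 : ∃ c : Fin n → A, (∀ i, c i ∈ I) ∧ ε v = ∑ i, a i * c i := by
        obtain ⟨c, -, hc⟩ := kSpan _ _ _ h1
        refine ⟨fun i => c i, fun i => (c i).2, ?_⟩
        have := congrArg Subtype.val hc
        simpa using this
      obtain ⟨c, hc, hc'⟩ := h2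
      intro i
      have h3 := kReg a hreg n le_rfl (fun i => φ i v - c i) (fun i hi => absurd i.2 (by omega))
        (by
          simp only [mul_sub, Finset.sum_sub_distrib]
          rw [← hc', hεφ]
          simp [LinearMap.sum_apply]) i
      rw [← hIdef] at h3
      have h4 := I.add_mem h3 (hc i)
      rwa [sub_add_cancel] at h4
    have hpv : p v = x := by
      apply Subtype.ext
      rw [hp, ← hv, Submodule.Quotient.eq, kP_apply, sub_sub_cancel_left]
      exact Submodule.neg_mem _ (Submodule.sum_mem _ fun i _ =>
        Submodule.smul_mem_smul (hφv i) trivial)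
    refine ⟨kP Finset.univ e φ v, hεP v, ?_⟩
    rw [← hpv]
    apply Subtype.ext
    rw [hp, hp]
    congr 1
    rw [kP_apply _ _ _ (kP Finset.univ e φ v), sub_eq_self]
    refine Finset.sum_eq_zero fun i _ => ?_
    have : φ i (kP Finset.univ e φ v) = 0 := by simp [kP_apply, he]
    rw [this, zero_smul]
  obtain ⟨Θ, hΘ⟩ := kTheta (B := A ⧸ I) p
  have hsm : ∀ (r : A) (x : ExteriorAlgebra (A ⧸ I) E), r • x = Ideal.Quotient.mk I r • x :=
    fun r x => (algebraMap_smul (A ⧸ I) r x).symm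
  have hdk : ∀ j (x : ⋀[A]^j F), (d j x : ExteriorAlgebra A F) = kC ε x := by
    intro j x
    rcases j with _ | j
    · rw [hd0, kDeg0 ε _ x.2]; rfl
    · have h1 : (Submodule.subtype _) ∘ₗ d (j + 1) = kC ε ∘ₗ Submodule.subtype _ := by
        apply exteriorPower.linearMap_ext
        ext f
        simp only [LinearMap.compAlternatingMap_apply, LinearMap.comp_apply,
          Submodule.subtype_apply]
        rw [hd j f _ rfl, exteriorPower.ιMulti_apply_coe, kC_ιMulti]
      exact LinearMap.congr_fun h1 x
  have hΘd : ∀ w, Θ (kC ε w) = 0 := by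
    intro w
    rw [hεφ, kC_sum, map_sum]
    refine Finset.sum_eq_zero fun i _ => ?_
    rw [map_smul, hsm,
      Ideal.Quotient.eq_zero_iff_mem.2 (haI i), zero_smul]
  intro j
  have hΘj : ∀ x ∈ ⋀[A]^j F, Θ x ∈ ⋀[A ⧸ I]^j E := by
    intro x hx
    rw [← ExteriorAlgebra.ιMulti_span_fixedDegree] at hx
    induction hx using Submodule.span_induction with
    | mem x hx =>
      obtain ⟨f, rfl⟩ := hx
      rw [kTheta_multi p Θ hΘ]
      exact ExteriorAlgebra.ιMulti_range _ j ⟨_, rfl⟩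
    | zero => rw [map_zero]; exact Submodule.zero_mem _
    | add x y _ _ hx hy => rw [map_add]; exact Submodule.add_mem _ hx hy
    | smul r x _ hx =>
      rw [map_smul, hsm]; exact Submodule.smul_mem _ _ hx
  have hsurj : ∀ y ∈ ⋀[A ⧸ I]^j E, ∃ x ∈ ⋀[A]^j F, kC ε x = 0 ∧ Θ x = y := by
    intro y hy
    rw [← ExteriorAlgebra.ιMulti_span_fixedDegree] at hy
    induction hy using Submodule.span_induction with
    | mem y hy =>
      obtain ⟨f, rfl⟩ := hy
      choose g hg hg' using fun i => hpE (f i)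
      refine ⟨ExteriorAlgebra.ιMulti A j g, ExteriorAlgebra.ιMulti_range _ j ⟨_, rfl⟩, ?_, ?_⟩
      · rcases j with _ | j
        · exact kDeg0 ε _ (ExteriorAlgebra.ιMulti_range _ 0 ⟨_, rfl⟩)
        · rw [kC_ιMulti]; simp [hg]
      · rw [kTheta_multi p Θ hΘ]; simp only [hg']
    | zero => exact ⟨0, Submodule.zero_mem _, map_zero _, map_zero _⟩
    | add x y _ _ hx hy =>
      obtain ⟨x1, h1, h2, h3⟩ := hx
      obtain ⟨y1, h4, h5, h6⟩ := hy
      exact ⟨x1 + y1, Submodule.add_mem _ h1 h4, by rw [map_add, h2, h5, add_zero],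
        by rw [map_add, h3, h6]⟩
    | smul r x _ hx =>
      obtain ⟨x1, h1, h2, h3⟩ := hx
      obtain ⟨r, rfl⟩ := Ideal.Quotient.mk_surjective r
      refine ⟨r • x1, Submodule.smul_mem _ _ h1, by rw [map_smul, h2, smul_zero], ?_⟩
      rw [map_smul, h3, hsm]
  letI : Module A ↥(⋀[A ⧸ I]^j ↥E) := Module.compHom _ (Ideal.Quotient.mk I)
  refine ⟨{ toFun := fun z => ⟨Θ (z : ⋀[A]^j F), hΘj _ (z : ⋀[A]^j F).2⟩
            map_add' := fun z w => Subtype.ext (map_add Θ _ _)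
            map_smul' := fun r z => Subtype.ext ?_ }, ?_, ?_⟩
  · change Θ (r • _) = Ideal.Quotient.mk I r • Θ _
    rw [map_smul, hsm]
  · rintro ⟨y, hy⟩
    obtain ⟨x, hx, hx1, hx2⟩ := hsurj y hy
    refine ⟨⟨⟨x, hx⟩, ?_⟩, Subtype.ext hx2⟩
    rw [LinearMap.mem_ker]
    apply Subtype.ext
    rw [hdk]
    exact hx1
  · ext z
    obtain ⟨⟨z, hzj⟩, hz⟩ := z
    have hz0 : kC ε z = 0 := by
      have := hdk j ⟨z, hzj⟩
      rw [LinearMap.mem_ker.1 hz] at this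
      exact this.symm
    rw [LinearMap.mem_ker, Submodule.mem_comap, LinearMap.mem_range]
    constructor
    · intro h
      have h1 : Θ z = 0 := congrArg Subtype.val h
      obtain ⟨w, hw⟩ := kMain a hreg e φ he ε hεφ z hz0 (hIdef ▸ kKer I E _ p hp Θ hΘ z h1)
      obtain ⟨w', hw', hw2⟩ := kProj ε j z w hzj hw
      refine ⟨⟨w', hw'⟩, Subtype.ext ?_⟩
      have := hdk (j + 1) ⟨w', hw'⟩
      exact this.trans hw2
    · rintro ⟨w, hw⟩
      apply Subtype.ext
      change Θ z = 0
      have h2 : (d (j + 1) w : ExteriorAlgebra A F) = z := congrArg Subtype.val hw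
      rw [← h2]
      have h3 := hdk (j + 1) w
      exact (congrArg Θ h3).trans (hΘd _)
end

section
/- Let l be a prime, let R be a commutative ring in which l is invertible, let C_l be the cyclic group of order l with generator c, let G = Aut(C_l) ≅ (ℤ/lℤ)^×, and let Γ = C_l ⋊ G. Let ε = l^{-1}·Σ_{i=0}^{l−1} c^i, an idempotent in the group algebra R[C_l]. Then for every R-module V with an R-linear Γ-action, there is an isomorphism of C_l-modules V ≅ εV ⊕ ( ((1−ε)V)^G ⊗_R ker(aug) ), where C_l acts trivially on εV and on ((1−ε)V)^G, and acts on ker(aug) ⊆ R[C_l] by left multiplication. -/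
open scoped TensorProduct in
theorem stmt14_aux {C R V : Type*} [CommGroup C] [Fintype C] [Fintype (MulAut C)]
    [CommRing R] [AddCommGroup V] [Module R V] (c : R) (hc : c * (Fintype.card C : R) = 1)
    (A : C →* (V →ₗ[R] V)) (T : MulAut C →* (V →ₗ[R] V))
    (hTA : ∀ σ a v, T σ (A a v) = A (σ a) (T σ v))
    (h0 : Fintype.card (MulAut C) + 1 = Fintype.card C)
    (h1 : ∀ σ : MulAut C, σ ≠ 1 → Function.Bijective (fun a : C => a * (σ a)⁻¹))
    (h2 : ∀ (g : C), g ≠ 1 → ∀ f : C → V, (∑ σ : MulAut C, f (σ g)) + f 1 = ∑ b, f b)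
    (P : V →ₗ[R] V) (hP : ∀ v, (Fintype.card C : R) • P v = ∑ a, A a v)
    (K : Submodule R (C →₀ R)) (hK : ∀ k, k ∈ K ↔ ∑ a, k a = 0)
    (W : Submodule R V)
    (hW : ∀ w, w ∈ W ↔ (∃ v, v - P v = w) ∧ ∀ σ, T σ w = w) :
    ∃ e : V ≃ₗ[R] (↥(LinearMap.range P) × ((↥W) ⊗[R] (↥K))),
      ∀ (a : C) (v : V),
        (e (A a v)).1 = (e v).1 ∧
        TensorProduct.map LinearMap.id K.subtype ((e (A a v)).2) =
          TensorProduct.map LinearMap.id (Finsupp.lmapDomain R R (a * ·))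
            (TensorProduct.map LinearMap.id K.subtype ((e v).2)) := by
  classical
  have hP' : ∀ v, P v = c • ∑ a, A a v := fun v => by
    rw [← hP, smul_smul, hc, one_smul]
  have hAmul : ∀ a b v, A a (A b v) = A (a * b) v := fun a b v => by simp [map_mul]
  have hTmul : ∀ a b v, T a (T b v) = T (a * b) v := fun a b v => by simp [map_mul]
  have hPA : ∀ a v, P (A a v) = P v := fun a v => by
    rw [hP', hP']
    congr 1
    simp only [hAmul]
    exact Fintype.sum_equiv (Equiv.mulRight a) _ _ (fun _ => rfl)
  have hAP : ∀ a v, A a (P v) = P v := fun a v => by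
    rw [hP', map_smul, map_sum]
    congr 1
    simp only [hAmul]
    exact Fintype.sum_equiv (Equiv.mulLeft a) _ _ (fun _ => rfl)
  have hTP : ∀ σ v, T σ (P v) = P (T σ v) := fun σ v => by
    rw [hP', hP', map_smul, map_sum]
    congr 1
    simp only [hTA]
    exact Fintype.sum_equiv σ.toEquiv _ _ (fun _ => rfl)
  have hPP : ∀ v, P (P v) = P v := fun v => by
    conv_lhs => rw [hP']
    simp only [hAP]
    rw [Finset.sum_const, Finset.card_univ, ← Nat.cast_smul_eq_nsmul R, smul_smul, hc, one_smul]
  have hPW : ∀ w ∈ W, P w = 0 := fun w hw => by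
    obtain ⟨⟨v, rfl⟩, -⟩ := (hW w).1 hw
    rw [map_sub, hPP, sub_self]
  -- the trace map
  let Tr0 : V →ₗ[R] V := c • ∑ σ : MulAut C, (T σ) ∘ₗ (LinearMap.id - P)
  have hTr0 : ∀ v, Tr0 v = c • ∑ σ : MulAut C, T σ (v - P v) := fun v => by
    simp [Tr0, LinearMap.sum_apply]
  have hTrW : ∀ v, Tr0 v ∈ W := fun v => by
    rw [hW, hTr0]
    constructor
    · refine ⟨c • ∑ σ : MulAut C, T σ v, ?_⟩
      rw [map_smul, map_sum, ← smul_sub, ← Finset.sum_sub_distrib]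
      simp only [map_sub, hTP]
    · intro σ
      rw [map_smul, map_sum]
      congr 1
      simp only [hTmul]
      exact Fintype.sum_equiv (Equiv.mulLeft σ) _ _ (fun _ => rfl)
  let Tr : V →ₗ[R] W := LinearMap.codRestrict W Tr0 hTrW
  have hTr : ∀ v, (Tr v : V) = c • ∑ σ : MulAut C, T σ (v - P v) := hTr0
  have hTrA : ∀ g (w : W), Tr (A g w) = (if g = 1 then w else 0) - c • w := fun g w => by
    apply Subtype.ext
    have hw := ((hW w).1 w.2).2
    rw [hTr, hPA, hPW w w.2, sub_zero]
    simp only [hTA, hw]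
    split_ifs with hg
    · subst hg
      simp only [map_one, Module.End.one_apply, Finset.sum_const, Finset.card_univ]
      rw [← Nat.cast_smul_eq_nsmul R, smul_smul]
      have : c * (Fintype.card (MulAut C) : R) = 1 - c := by
        rw [← hc, ← h0]; push_cast; ring
      rw [this, sub_smul, one_smul]
      rfl
    · have h := h2 g hg (fun b => A b w)
      rw [← hP, hPW w w.2, smul_zero] at h
      rw [eq_neg_of_add_eq_zero_left h]
      simp
  -- elements of K
  let d0 : C → (C →₀ R) := fun a => Finsupp.single a 1 - ∑ b, Finsupp.single b c
  have hd0 : ∀ a b, d0 a b = (if a = b then 1 else 0) - c := fun a b => by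
    simp [d0, Finsupp.single_apply, Finsupp.finsetSum_apply]
  have hd0K : ∀ a, d0 a ∈ K := fun a => by
    rw [hK]
    simp only [hd0, Finset.sum_sub_distrib, Finset.sum_const, Finset.card_univ, nsmul_eq_mul]
    rw [mul_comm, hc]; simp
  let d : C → K := fun a => ⟨d0 a, hd0K a⟩
  have hkd : ∀ k : K, ∑ a, (k : C →₀ R) a • d a = k := fun k => by
    have hk := (hK k).1 k.2
    apply Subtype.ext
    ext b
    simp only [AddSubmonoidClass.coe_finsetSum, Submodule.coe_smul, Finsupp.finsetSum_apply,
      Finsupp.smul_apply, d, hd0, smul_eq_mul, mul_sub, Finset.sum_sub_distrib, ← Finset.sum_mul, hk]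
    simp
  let ψ : V →ₗ[R] (W ⊗[R] K) :=
    ∑ a : C, ((TensorProduct.mk R W K).flip (d a)) ∘ₗ Tr ∘ₗ (A a⁻¹)
  have hψ : ∀ v, ψ v = ∑ a : C, Tr (A a⁻¹ v) ⊗ₜ[R] d a := fun v => by
    simp [ψ, LinearMap.sum_apply]
  let φ : (W ⊗[R] K) →ₗ[R] V := TensorProduct.lift
    (∑ a : C, LinearMap.mk₂ R (fun (w : W) (k : K) => (k : C →₀ R) a • A a (w : V))
      (by intros; simp) (by intro r w k; simp only [Submodule.coe_smul, map_smul]; exact smul_comm _ _ _) (by intros; simp [add_smul])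
      (by intros; simp [mul_smul]))
  have hφ : ∀ (w : W) (k : K), φ (w ⊗ₜ k) = ∑ a : C, (k : C →₀ R) a • A a (w : V) :=
    fun w k => by simp [φ, LinearMap.sum_apply]
  have hφd : ∀ (w : W) a, φ (w ⊗ₜ d a) = A a (w : V) := fun w a => by
    rw [hφ]
    simp only [d, hd0, sub_smul, Finset.sum_sub_distrib]
    rw [← Finset.smul_sum, ← hP', hPW w w.2]
    simp
  have hφψ : ∀ v, φ (ψ v) = v - P v := fun v => by
    rw [hψ, map_sum]
    simp only [hφd, hTr, hPA, map_smul, map_sum]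
    rw [← Finset.smul_sum, Finset.sum_comm]
    have key : ∀ σ : MulAut C, ∑ a, A a (T σ (A a⁻¹ v - P v)) =
        if σ = 1 then (Fintype.card C : R) • (v - P v) else 0 := by
      intro σ
      have e1 : ∀ a, A a (T σ (A a⁻¹ v - P v)) = A (a * (σ a)⁻¹) (T σ (v - P v)) := by
        intro a
        rw [← hAmul, ← map_inv σ a, ← hTA, map_sub (A a⁻¹), hAP]
      simp only [e1]
      split_ifs with hs
      · subst hs
        simp only [MulAut.one_apply, mul_inv_cancel, map_one, Module.End.one_apply,
          Finset.sum_const, Finset.card_univ]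
        rw [Nat.cast_smul_eq_nsmul R]
      · rw [Fintype.sum_bijective _ (h1 σ hs) _ (fun b => A b (T σ (v - P v))) (fun _ => rfl),
          ← hP, ← hTP, map_sub P, hPP, sub_self, map_zero, smul_zero]
    have key' := fun σ => key σ
    simp only [map_sub] at key' ⊢
    simp only [key', Finset.sum_ite_eq', Finset.mem_univ, if_true]
    rw [smul_smul, hc, one_smul]
  have hψφ : ∀ t, ψ (φ t) = t := fun t => by
    induction t with
    | zero => simp
    | add x y hx hy => rw [map_add, map_add, hx, hy]
    | tmul w k =>
      have hk := (hK k).1 k.2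
      have e1 : ∀ a, Tr (A a⁻¹ (φ (w ⊗ₜ k))) = (k : C →₀ R) a • w := by
        intro a
        rw [hφ]
        simp only [map_sum, map_smul, hAmul, hTrA, smul_sub, Finset.sum_sub_distrib]
        rw [← Finset.sum_smul, hk, zero_smul, sub_zero]
        simp [inv_mul_eq_one]
      rw [hψ]
      simp only [e1, TensorProduct.smul_tmul]
      rw [← TensorProduct.tmul_sum, hkd]
  have hPφ : ∀ t, P (φ t) = 0 := fun t => by
    induction t with
    | zero => simp
    | add x y hx hy => rw [map_add, map_add, hx, hy, add_zero]
    | tmul w k =>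
      rw [hφ]
      simp [hPA, hPW w w.2]
  have hψP : ∀ v, ψ (P v) = 0 := fun v => by
    have : Tr (P v) = 0 := by
      apply Subtype.ext
      rw [hTr, hPP]; simp
    rw [hψ]
    simp [hAP, this]
  let e : V ≃ₗ[R] (↥(LinearMap.range P) × ((↥W) ⊗[R] (↥K))) :=
    LinearEquiv.ofLinear (P.rangeRestrict.prod ψ)
      ((LinearMap.range P).subtype.coprod φ)
      (by
        apply LinearMap.ext
        rintro ⟨⟨_, v, rfl⟩, t⟩
        refine Prod.ext (Subtype.ext ?_) ?_
        · simp [hPφ, hPP]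
        · simp [hψP, hψφ])
      (by
        apply LinearMap.ext
        intro v
        simp [hφψ])
  refine ⟨e, fun a v => ⟨Subtype.ext (hPA a v), ?_⟩⟩
  change TensorProduct.map LinearMap.id K.subtype (ψ (A a v)) =
    TensorProduct.map LinearMap.id (Finsupp.lmapDomain R R (a * ·))
            (TensorProduct.map LinearMap.id K.subtype (ψ v))
  have hda : ∀ b, Finsupp.lmapDomain R R (a * ·) (d0 b) = d0 (a * b) := by
    intro b
    simp only [d0, map_sub, map_sum, Finsupp.lmapDomain_apply, Finsupp.mapDomain_single]
    congr 1
    exact Fintype.sum_equiv (Equiv.mulLeft a) _ _ (fun _ => rfl)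
  simp only [hψ, map_sum, TensorProduct.map_tmul, hAmul, LinearMap.id_apply, Submodule.subtype_apply, d, hda]
  refine (Fintype.sum_equiv (Equiv.mulLeft a) _ _ (fun b => ?_)).symm
  simp


open scoped TensorProduct in
/-- Let `l` be a prime invertible in `R`, `C_l` the cyclic group of order `l` with
generator `c`, `G = Aut(C_l)`, `Γ = C_l ⋊ G`, and `ε = l⁻¹ ∑ᵢ cⁱ ∈ R[C_l]`
(realized on a `Γ`-representation `V` by the operator `P`).  Then there is an
isomorphism of `C_l`-modules `V ≅ εV ⊕ (((1−ε)V)^G ⊗_R ker(aug))`, where `C_l` acts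
trivially on `εV` and on `((1−ε)V)^G` and by left multiplication on the augmentation
ideal `ker(aug) ⊆ R[C_l]`. -/
theorem stmt_14 (l : ℕ) (hl : l.Prime) [NeZero l]
    (R : Type*) [CommRing R] (hinv : IsUnit (l : R))
    (V : Type*) [AddCommGroup V] [Module R V]
    (ρ : Representation R
      (Multiplicative (ZMod l) ⋊[MonoidHom.id (MulAut (Multiplicative (ZMod l)))]
        MulAut (Multiplicative (ZMod l))) V)
    (P : V →ₗ[R] V)
    (hP : ∀ v : V, (l : R) • P v =
      ∑ i : ZMod l, ρ (SemidirectProduct.inl (Multiplicative.ofAdd i)) v)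
    (aug : (Multiplicative (ZMod l) →₀ R) →ₗ[R] R)
    (haug : ∀ (a : Multiplicative (ZMod l)) (r : R), aug (Finsupp.single a r) = r)
    (K : Submodule R (Multiplicative (ZMod l) →₀ R)) (hK : K = LinearMap.ker aug)
    (W : Submodule R V)
    (hW : W = LinearMap.range (LinearMap.id - P) ⊓
      ⨅ σ : MulAut (Multiplicative (ZMod l)),
        LinearMap.ker (ρ (SemidirectProduct.inr σ) - LinearMap.id)) :
    ∃ e : V ≃ₗ[R] (↥(LinearMap.range P) × ((↥W) ⊗[R] (↥K))),
      ∀ (a : Multiplicative (ZMod l)) (v : V),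
        (e (ρ (SemidirectProduct.inl a) v)).1 = (e v).1 ∧
        TensorProduct.map LinearMap.id K.subtype ((e (ρ (SemidirectProduct.inl a) v)).2) =
          TensorProduct.map LinearMap.id (Finsupp.lmapDomain R R (a * ·))
            (TensorProduct.map LinearMap.id K.subtype ((e v).2)) := by

  classical
  haveI : Fact l.Prime := ⟨hl⟩
  letI : Fintype (MulAut (Multiplicative (ZMod l))) := Fintype.ofFinite _
  have hcard : Fintype.card (Multiplicative (ZMod l)) = l := by simp [ZMod.card]
  have hncard : Nat.card (Multiplicative (ZMod l)) = l := by simp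
  obtain ⟨c, hc⟩ := hinv.exists_left_inv
  have hinj : ∀ g : Multiplicative (ZMod l), g ≠ 1 →
      ∀ σ τ : MulAut (Multiplicative (ZMod l)), σ g = τ g → σ = τ := by
    intro g hg σ τ h
    ext1 b
    obtain ⟨n, rfl⟩ := mem_powers_of_prime_card hncard hg (g' := b)
    simp [h]
  have hsurj : ∀ g : Multiplicative (ZMod l), g ≠ 1 → ∀ b : Multiplicative (ZMod l), b ≠ 1 →
      ∃ σ : MulAut (Multiplicative (ZMod l)), σ g = b := by
    intro g hg b hb
    have hg' : g.toAdd ≠ 0 := hg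
    have hb' : b.toAdd ≠ 0 := hb
    refine ⟨AddEquiv.toMultiplicative
      (AddAut.mulLeft (Units.mk0 (b.toAdd / g.toAdd) (div_ne_zero hb' hg'))), ?_⟩
    apply Multiplicative.toAdd.injective
    change (b.toAdd / g.toAdd) * g.toAdd = b.toAdd
    exact div_mul_cancel₀ _ hg'
  have h2 : ∀ {M : Type _} [AddCommMonoid M], ∀ (g : Multiplicative (ZMod l)), g ≠ 1 →
      ∀ f : Multiplicative (ZMod l) → M,
      (∑ σ : MulAut (Multiplicative (ZMod l)), f (σ g)) + f 1 = ∑ b, f b := by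
    intro M _ g hg f
    rw [← Finset.sum_erase_add _ _ (Finset.mem_univ (1 : Multiplicative (ZMod l)))]
    congr 1
    refine Finset.sum_bij (fun σ _ => σ g) ?_ ?_ ?_ ?_
    · intro σ _
      simpa using hg
    · intro σ _ τ _ h
      exact hinj g hg σ τ h
    · intro b hb
      obtain ⟨σ, h⟩ := hsurj g hg b (Finset.ne_of_mem_erase hb)
      exact ⟨σ, Finset.mem_univ _, h⟩
    · intros; rfl
  have h0 : Fintype.card (MulAut (Multiplicative (ZMod l))) + 1 =
      Fintype.card (Multiplicative (ZMod l)) := by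
    have hone : (Multiplicative.ofAdd (1 : ZMod l)) ≠ 1 := by
      intro h
      exact one_ne_zero (α := ZMod l) h
    rw [← Finset.card_univ, ← Finset.card_univ, ← Finset.card_erase_add_one (Finset.mem_univ (1 : Multiplicative (ZMod l)))]
    congr 1
    refine Finset.card_bij (fun σ _ => σ (Multiplicative.ofAdd (1 : ZMod l))) ?_ ?_ ?_
    · intro σ _
      simpa using hone
    · intro σ _ τ _ h
      exact hinj _ hone σ τ h
    · intro b hb
      obtain ⟨σ, h⟩ := hsurj _ hone b (Finset.ne_of_mem_erase hb)
      exact ⟨σ, Finset.mem_univ _, h⟩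
  refine stmt14_aux c (by rw [hcard]; exact hc) (ρ.comp SemidirectProduct.inl)
    (ρ.comp SemidirectProduct.inr) ?_ h0 ?_ (fun g hg f => h2 g hg f) P ?_ K ?_ W ?_
  · intro σ a v
    have := SemidirectProduct.inl_aut (φ := MonoidHom.id (MulAut (Multiplicative (ZMod l)))) σ a
    simp only [MonoidHom.id_apply] at this
    simp only [MonoidHom.comp_apply, this, map_mul, Module.End.mul_apply]
    rw [← Module.End.mul_apply (ρ (SemidirectProduct.inr σ⁻¹)), ← map_mul, ← map_mul]
    simp
  · intro σ hσ
    rw [← Finite.injective_iff_bijective]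
    intro a b hab
    by_contra hne
    apply hσ
    refine hinj (a * b⁻¹) (fun h => hne (mul_inv_eq_one.1 h)) σ 1 ?_
    simp only at hab
    simp only [map_mul, map_inv, MulAut.one_apply]
    rw [mul_inv_eq_iff_eq_mul] at hab
    rw [eq_mul_inv_iff_mul_eq]
    conv_rhs => rw [hab]
    rw [mul_right_comm b, mul_comm b, mul_right_comm]
  · intro v
    rw [hcard, hP]
    exact Fintype.sum_equiv Multiplicative.ofAdd _ _ (fun _ => rfl)
  · intro k
    have : aug k = ∑ a, k a := by
      conv_lhs => rw [← Finsupp.univ_sum_single k]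
      simp only [map_sum, haug]
    rw [hK, LinearMap.mem_ker, this]
  · intro w
    rw [hW]
    simp [Submodule.mem_inf, Submodule.mem_iInf, sub_eq_zero]
end
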